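/- arXiv:2212.14495 — 2 statements merged into one kernel-verified Lean document; each statement's English description precedes it below -/
import Mathlib

section
/- Let a be a real number and let g be the 4-dimensional real Lie algebra Type[2] with basis y1, y2, y3, y4 and nonzero brackets [y1,y4]=a·y1, [y2,y4]=y2, [y3,y4]=y2+y3 (all other basis brackets zero, up to skew-symmetry). Then g admits an Engel-like structure if and only if a ≠ 1; when a ≠ 1, the 2-dimensional subspace D spanned by w1 = y4 and w2 = y1 + y3 is an Engel-like structure, and when a = 1 no 2-dimensional subspace of g is an Engel-like structure. -/
/-- The subspace spanned by all brackets `⁅u, v⁆` with `u ∈ S`, `v ∈ T`. -/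
def brL {L : Type*} [LieRing L] [LieAlgebra ℝ L] (S T : Submodule ℝ L) : Submodule ℝ L :=
  Submodule.span ℝ {z | ∃ u ∈ S, ∃ v ∈ T, z = ⁅u, v⁆}

/-- `D` is an Engel-like structure on the real Lie algebra `L`: `D` is 2-dimensional,
`D[2] = D + [D,D]` is 3-dimensional and `D[3] = D[2] + [D[2],D[2]]` is 4-dimensional. -/
def IsEngelLike {L : Type*} [LieRing L] [LieAlgebra ℝ L] (D : Submodule ℝ L) : Prop :=
  Module.finrank ℝ D = 2 ∧
  Module.finrank ℝ ↥(D ⊔ brL D D) = 3 ∧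
  Module.finrank ℝ ↥((D ⊔ brL D D) ⊔ brL (D ⊔ brL D D) (D ⊔ brL D D)) = 4

theorem type2_engel_structure_iff (L : Type*) [LieRing L] [LieAlgebra ℝ L]
    (y : Module.Basis (Fin 4) ℝ L) (a : ℝ)
    (h12 : ⁅y 0, y 1⁆ = 0)
    (h13 : ⁅y 0, y 2⁆ = 0)
    (h14 : ⁅y 0, y 3⁆ = a • y 0)
    (h23 : ⁅y 1, y 2⁆ = 0)
    (h24 : ⁅y 1, y 3⁆ = y 1)
    (h34 : ⁅y 2, y 3⁆ = y 1 + y 2) :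
    ((∃ D : Submodule ℝ L, IsEngelLike D) ↔ a ≠ 1) ∧
    (a ≠ 1 → IsEngelLike (Submodule.span ℝ {y 3, y 0 + y 2})) ∧
    (a = 1 → ∀ D : Submodule ℝ L, ¬IsEngelLike D) := by
  have h21 : ⁅y 1, y 0⁆ = 0 := by rw [← lie_skew, h12, neg_zero]
  have h31 : ⁅y 2, y 0⁆ = 0 := by rw [← lie_skew, h13, neg_zero]
  have h32 : ⁅y 2, y 1⁆ = 0 := by rw [← lie_skew, h23, neg_zero]
  have h41 : ⁅y 3, y 0⁆ = -(a • y 0) := by rw [← lie_skew, h14]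
  have h42 : ⁅y 3, y 1⁆ = -y 1 := by rw [← lie_skew, h24]
  have h43 : ⁅y 3, y 2⁆ = -(y 1 + y 2) := by rw [← lie_skew, h34]
  have : FiniteDimensional ℝ L := y.finiteDimensional_of_finite
  have hL : Module.finrank ℝ L = 4 := by simpa using Module.finrank_eq_card_basis y
  have key : a ≠ 1 → IsEngelLike (Submodule.span ℝ {y 3, y 0 + y 2}) := by
    intro ha
    set D := Submodule.span ℝ {y 3, y 0 + y 2} with hD
    have m3 : y 3 ∈ D := Submodule.subset_span (by simp)
    have m02 : y 0 + y 2 ∈ D := Submodule.subset_span (by simp)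
    have hl : LinearIndependent ℝ ![y 3, y 0 + y 2, a • y 0 + y 1 + y 2] := by
      rw [Fintype.linearIndependent_iff]
      intro g hg
      have hg' := fun j => congrArg (fun v => y.repr v j) hg
      simp only [Fin.sum_univ_three] at hg'
      have e0 := hg' 0
      have e1 := hg' 1
      have e2 := hg' 2
      have e3 := hg' 3
      simp at e0 e1 e2 e3
      intro i
      fin_cases i <;> simp <;> simp_all
    have hl2 : LinearIndependent ℝ ![y 3, y 0 + y 2] := by
      have := hl.comp (![0, 1] : Fin 2 → Fin 3) (by decide)
      convert this using 1
      ext i; fin_cases i <;> rfl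
    have hb : D ⊔ brL D D = Submodule.span ℝ (Set.range ![y 3, y 0 + y 2, a • y 0 + y 1 + y 2]) := by
      apply le_antisymm
      · apply sup_le
        · rw [hD]
          apply Submodule.span_mono
          rintro x (rfl | rfl)
          · exact ⟨0, rfl⟩
          · exact ⟨1, rfl⟩
        · apply Submodule.span_le.2
          rintro z ⟨u, hu, v, hv, rfl⟩
          obtain ⟨p, q, rfl⟩ := Submodule.mem_span_pair.1 hu
          obtain ⟨r, s, rfl⟩ := Submodule.mem_span_pair.1 hv
          have : ⁅p • y 3 + q • (y 0 + y 2), r • y 3 + s • (y 0 + y 2)⁆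
              = (q * r - p * s) • (a • y 0 + y 1 + y 2) := by
            simp only [lie_add, add_lie, smul_lie, lie_smul, lie_self, h13, h14, h31, h41, h43, h34]
            module
          rw [this]
          exact Submodule.smul_mem _ _ (Submodule.subset_span ⟨2, rfl⟩)
      · apply Submodule.span_le.2
        rintro x ⟨i, rfl⟩
        fin_cases i
        · exact Submodule.mem_sup_left m3
        · exact Submodule.mem_sup_left m02
        · refine Submodule.mem_sup_right (Submodule.subset_span ⟨y 0 + y 2, m02, y 3, m3, ?_⟩)
          simp [h14, h34, add_assoc]
    refine ⟨?_, ?_, ?_⟩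
    · have := finrank_span_eq_card hl2
      have hr : Set.range ![y 3, y 0 + y 2] = {y 3, y 0 + y 2} := by
        ext x; simp; tauto
      rw [hr, ← hD] at this
      simpa using this
    · rw [hb]
      simpa using finrank_span_eq_card hl
    · set E := D ⊔ brL D D
      have n3 : y 3 ∈ E := Submodule.mem_sup_left m3
      have n02 : y 0 + y 2 ∈ E := Submodule.mem_sup_left m02
      have nw : a • y 0 + y 1 + y 2 ∈ E := by
        rw [hb]; exact Submodule.subset_span ⟨2, rfl⟩
      have nz : (a * a) • y 0 + (2 : ℝ) • y 1 + y 2 ∈ E ⊔ brL E E := by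
        refine Submodule.mem_sup_right (Submodule.subset_span ⟨_, nw, y 3, n3, ?_⟩)
        simp only [add_lie, smul_lie, h14, h24, h34]
        module
      have hE : E ≤ E ⊔ brL E E := le_sup_left
      generalize E ⊔ brL E E = F at nz hE
      have f3 := hE n3
      have f02 := hE n02
      have fw := hE nw
      have hne : (a - 1) ^ 2 ≠ 0 := pow_ne_zero _ (sub_ne_zero.2 ha)
      have f0 : y 0 ∈ F := by
        have := F.add_mem (F.sub_mem f02 (F.smul_mem (2 : ℝ) fw)) nz
        have h2 : (a - 1) ^ 2 • y 0 ∈ F := by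
          convert this using 1
          module
        exact (F.smul_mem_iff hne).1 h2
      have f2 : y 2 ∈ F := by simpa using F.sub_mem f02 f0
      have f1 : y 1 ∈ F := by
        have := F.sub_mem (F.sub_mem fw f2) (F.smul_mem a f0)
        convert this using 1
        module
      have : F = ⊤ := by
        rw [eq_top_iff, ← y.span_eq]
        apply Submodule.span_le.2
        rintro x ⟨i, rfl⟩
        fin_cases i <;> assumption
      rw [this, finrank_top, hL]
  have key2 : a = 1 → ∀ D : Submodule ℝ L, ¬IsEngelLike D := by
    rintro rfl D ⟨hD2, -, hD4⟩
    have form : ∀ u v : L, ⁅u, v⁆ = y.repr v 3 • u - y.repr u 3 • v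
        + (y.repr u 2 * y.repr v 3 - y.repr u 3 * y.repr v 2) • y 1 := by
      intro u v
      have hu := y.sum_repr u
      have hv := y.sum_repr v
      rw [Fin.sum_univ_four] at hu hv
      generalize y.repr u 0 = u0 at *
      generalize y.repr u 1 = u1 at *
      generalize y.repr u 2 = u2 at *
      generalize y.repr u 3 = u3 at *
      generalize y.repr v 0 = v0 at *
      generalize y.repr v 1 = v1 at *
      generalize y.repr v 2 = v2 at *
      generalize y.repr v 3 = v3 at *
      rw [← hu, ← hv]
      simp only [lie_add, add_lie, smul_lie, lie_smul, lie_self, h12, h13, h14, h23, h24, h34,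
        h21, h31, h32, h41, h42, h43]
      module
    set M := D ⊔ Submodule.span ℝ {y 1} with hM
    have hy : y 1 ∈ M := Submodule.mem_sup_right (Submodule.mem_span_singleton_self _)
    have sub : ∀ S : Submodule ℝ L, S ≤ M → S ⊔ brL S S ≤ M := by
      intro S hS
      refine sup_le hS (Submodule.span_le.2 ?_)
      rintro z ⟨u, hu, v, hv, rfl⟩
      rw [form]
      exact M.add_mem (M.sub_mem (M.smul_mem _ (hS hu)) (M.smul_mem _ (hS hv))) (M.smul_mem _ hy)
    have h1 := Submodule.finrank_mono (sub _ (sub D le_sup_left))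
    have h2 := Submodule.finrank_add_le_finrank_add_finrank D (Submodule.span ℝ {y 1})
    have h3 := finrank_span_singleton (K := ℝ) (y.ne_zero 1)
    rw [← hM] at h2
    omega
  refine ⟨⟨?_, fun h => ⟨_, key h⟩⟩, key, key2⟩
  rintro ⟨D, hD⟩ h
  exact key2 h D hD
end

section
/- Let b be a real number with −1 < b ≤ 1 and let g be the 4-dimensional real Lie algebra Type[9] with basis y1, y2, y3, y4 and nonzero brackets [y1,y4]=(1+b)·y1, [y2,y3]=y1, [y2,y4]=y2, [y3,y4]=b·y3 (all other basis brackets zero, up to skew-symmetry). Then g admits an Engel-like structure if and only if b ≠ 1; when b ≠ 1, the 2-dimensional subspace spanned by w1 = y1+y2+y3+y4 and w2 = y4 is an Engel-like structure, and when b = 1 no 2-dimensional subspace of g is an Engel-like structure. -/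
theorem coordEqs_aux {L : Type*} [AddCommGroup L] [Module ℝ L] (y : Module.Basis (Fin 4) ℝ L)
    (a b c d : ℝ) (h : a • y 0 + b • y 1 + c • y 2 + d • y 3 = 0) :
    a = 0 ∧ b = 0 ∧ c = 0 ∧ d = 0 := by
  have := Fintype.linearIndependent_iff.1 y.linearIndependent ![a, b, c, d]
    (by simpa [Fin.sum_univ_four] using h)
  exact ⟨this 0, this 1, this 2, this 3⟩

theorem type9_engel_structure_iff (L : Type*) [LieRing L] [LieAlgebra ℝ L]
    (y : Module.Basis (Fin 4) ℝ L) (b : ℝ)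
    (hb1 : -1 < b)
    (hb2 : b ≤ 1)
    (h12 : ⁅y 0, y 1⁆ = 0)
    (h13 : ⁅y 0, y 2⁆ = 0)
    (h14 : ⁅y 0, y 3⁆ = (1 + b) • y 0)
    (h23 : ⁅y 1, y 2⁆ = y 0)
    (h24 : ⁅y 1, y 3⁆ = y 1)
    (h34 : ⁅y 2, y 3⁆ = b • y 2) :
    ((∃ D : Submodule ℝ L, IsEngelLike D) ↔ b ≠ 1) ∧
    (b ≠ 1 → IsEngelLike (Submodule.span ℝ {y 0 + y 1 + y 2 + y 3, y 3})) ∧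
    (b = 1 → ∀ D : Submodule ℝ L, ¬IsEngelLike D) := by
  have h21 : ⁅y 1, y 0⁆ = 0 := by rw [← lie_skew, h12, neg_zero]
  have h31 : ⁅y 2, y 0⁆ = 0 := by rw [← lie_skew, h13, neg_zero]
  have h41 : ⁅y 3, y 0⁆ = -((1 + b) • y 0) := by rw [← lie_skew, h14]
  have h32 : ⁅y 2, y 1⁆ = -y 0 := by rw [← lie_skew, h23]
  have h42 : ⁅y 3, y 1⁆ = -y 1 := by rw [← lie_skew, h24]
  have h43 : ⁅y 3, y 2⁆ = -(b • y 2) := by rw [← lie_skew, h34]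
  have hfin : Module.Finite ℝ L := Module.Finite.of_basis y
  have hdim : Module.finrank ℝ L = 4 := by simp [Module.finrank_eq_card_basis y]
  have key1 : b ≠ 1 → IsEngelLike (Submodule.span ℝ {y 0 + y 1 + y 2 + y 3, y 3}) := by
    intro hb
    have hb' : b - 1 ≠ 0 := sub_ne_zero.2 hb
    have hw : ⁅y 0 + y 1 + y 2 + y 3, y 3⁆ = (1 + b) • y 0 + y 1 + b • y 2 := by
      simp [h14, h24, h34]
    have hE : Submodule.span ℝ {y 0 + y 1 + y 2 + y 3, y 3} ⊔
        brL (Submodule.span ℝ {y 0 + y 1 + y 2 + y 3, y 3})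
          (Submodule.span ℝ {y 0 + y 1 + y 2 + y 3, y 3}) =
        Submodule.span ℝ (Set.range ![y 0 + y 1 + y 2 + y 3, y 3,
          (1 + b) • y 0 + y 1 + b • y 2]) := by
      have m : ∀ i, ![y 0 + y 1 + y 2 + y 3, y 3, (1 + b) • y 0 + y 1 + b • y 2] i ∈
          Submodule.span ℝ (Set.range ![y 0 + y 1 + y 2 + y 3, y 3,
          (1 + b) • y 0 + y 1 + b • y 2]) := fun i => Submodule.subset_span ⟨i, rfl⟩
      apply le_antisymm
      · apply sup_le
        · rw [Submodule.span_le]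
          rintro x (rfl | rfl)
          · exact m 0
          · exact m 1
        · unfold brL
          rw [Submodule.span_le]
          rintro x ⟨u, hu, v, hv, rfl⟩
          obtain ⟨a, c, rfl⟩ := Submodule.mem_span_pair.1 hu
          obtain ⟨a', c', rfl⟩ := Submodule.mem_span_pair.1 hv
          have hw' := hw
          rw [← lie_skew] at hw'
          have : ⁅a • (y 0 + y 1 + y 2 + y 3) + c • y 3, a' • (y 0 + y 1 + y 2 + y 3) + c' • y 3⁆
              = (a * c' - c * a') • ((1 + b) • y 0 + y 1 + b • y 2) := by
            generalize y 0 + y 1 + y 2 + y 3 = w at hw hw'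
            rw [← hw]
            have e : ⁅y 3, w⁆ = -⁅w, y 3⁆ := (lie_skew _ _).symm
            simp only [add_lie, lie_add, smul_lie, lie_smul, lie_self, e]
            module
          rw [this]
          exact Submodule.smul_mem _ _ (m 2)
      · rw [Submodule.span_le]
        rintro x ⟨i, rfl⟩
        have m0 : y 0 + y 1 + y 2 + y 3 ∈ Submodule.span ℝ {y 0 + y 1 + y 2 + y 3, y 3} :=
          Submodule.subset_span (by simp)
        have m1 : y 3 ∈ Submodule.span ℝ {y 0 + y 1 + y 2 + y 3, y 3} :=
          Submodule.subset_span (by simp)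
        fin_cases i
        · exact Submodule.mem_sup_left m0
        · exact Submodule.mem_sup_left m1
        · exact Submodule.mem_sup_right (Submodule.subset_span ⟨_, m0, _, m1, hw.symm⟩)
    have li3 : LinearIndependent ℝ ![y 0 + y 1 + y 2 + y 3, y 3,
          (1 + b) • y 0 + y 1 + b • y 2] := by
      rw [Fintype.linearIndependent_iff]
      intro g hg
      simp only [Fin.sum_univ_three, Matrix.cons_val] at hg
      obtain ⟨e0, e1, e2, e3⟩ := coordEqs_aux y (g 0 + g 2 * (1 + b)) (g 0 + g 2)
        (g 0 + g 2 * b) (g 0 + g 1) (by rw [← hg]; module)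
      have f2 : g 2 = 0 := by linarith
      have f0 : g 0 = 0 := by linarith
      have f1 : g 1 = 0 := by linarith
      intro i
      fin_cases i <;> assumption
    refine ⟨?_, ?_, ?_⟩
    · have li2 : LinearIndependent ℝ ![y 0 + y 1 + y 2 + y 3, y 3] := by
        rw [LinearIndependent.pair_iff]
        intro s t h
        obtain ⟨e0, e1, e2, e3⟩ := coordEqs_aux y s s s (s + t) (by rw [← h]; module)
        exact ⟨e0, by linarith⟩
      have := finrank_span_eq_card li2
      rw [Matrix.range_cons, Matrix.range_cons, Matrix.range_empty, Set.union_empty, Set.singleton_union] at this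
      simpa using this
    · rw [hE, finrank_span_eq_card li3]; simp
    · rw [hE]
      set E := Submodule.span ℝ (Set.range ![y 0 + y 1 + y 2 + y 3, y 3,
          (1 + b) • y 0 + y 1 + b • y 2]) with hEd
      have m0 : y 0 + y 1 + y 2 + y 3 ∈ E := Submodule.subset_span ⟨0, rfl⟩
      have m1 : y 3 ∈ E := Submodule.subset_span ⟨1, rfl⟩
      have m2 : (1 + b) • y 0 + y 1 + b • y 2 ∈ E := Submodule.subset_span ⟨2, rfl⟩
      have m3 : y 0 + y 1 + y 2 ∈ E := by
        have := E.sub_mem m0 m1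
        simpa using this
      have n0 : (b - 1) • y 0 ∈ E ⊔ brL E E := by
        refine Submodule.mem_sup_right (Submodule.subset_span ⟨_, m3, _, m2, ?_⟩)
        simp only [add_lie, lie_add, lie_smul, lie_self, h12, h13, h23, h21, h31, h32]
        module
      have p0 : y 0 ∈ E ⊔ brL E E := (Submodule.smul_mem_iff _ hb').1 n0
      have q2 := Submodule.mem_sup_left (T := brL E E) m2
      have q3 := Submodule.mem_sup_left (T := brL E E) m3
      have p2 : y 2 ∈ E ⊔ brL E E := by
        rw [← Submodule.smul_mem_iff _ hb']
        have := Submodule.sub_mem _ (Submodule.sub_mem _ q2 q3) (Submodule.smul_mem _ b p0)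
        convert this using 1
        module
      have p1 : y 1 ∈ E ⊔ brL E E := by
        have := Submodule.sub_mem _ (Submodule.sub_mem _ q3 p0) p2
        convert this using 1
        module
      have p3 : y 3 ∈ E ⊔ brL E E := Submodule.mem_sup_left m1
      have top : E ⊔ brL E E = ⊤ := by
        rw [eq_top_iff, ← y.span_eq, Submodule.span_le]
        rintro x ⟨i, rfl⟩
        fin_cases i <;> assumption
      rw [top, finrank_top, hdim]
  have key2 : b = 1 → ∀ D : Submodule ℝ L, ¬IsEngelLike D := by
    rintro rfl D ⟨d2, -, d4⟩
    have form : ∀ u v : L, ∃ p q r : ℝ, ⁅u, v⁆ = p • u + q • v + r • y 0 := by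
      intro u v
      have hu := y.sum_repr u
      have hv := y.sum_repr v
      rw [Fin.sum_univ_four] at hu hv
      generalize y.repr u 0 = a0, y.repr u 1 = a1, y.repr u 2 = a2, y.repr u 3 = a3 at hu
      generalize y.repr v 0 = c0, y.repr v 1 = c1, y.repr v 2 = c2, y.repr v 3 = c3 at hv
      refine ⟨c3, -a3, a0 * c3 - a3 * c0 + a1 * c2 - a2 * c1, ?_⟩
      rw [← hu, ← hv]
      simp only [add_lie, lie_add, smul_lie, lie_smul, lie_self, h12, h13, h14, h23, h24, h34,
        h21, h31, h41, h32, h42, h43]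
      module
    set F := D ⊔ Submodule.span ℝ {y 0} with hF
    have y0 : y 0 ∈ F := Submodule.mem_sup_right (Submodule.mem_span_singleton_self _)
    have cl : ∀ S ≤ F, S ⊔ brL S S ≤ F := by
      intro S hS
      refine sup_le hS ?_
      unfold brL
      rw [Submodule.span_le]
      rintro x ⟨u, hu, v, hv, rfl⟩
      obtain ⟨p, q, r, e⟩ := form u v
      rw [e]
      exact F.add_mem (F.add_mem (F.smul_mem _ (hS hu)) (F.smul_mem _ (hS hv))) (F.smul_mem _ y0)
    have hle := Submodule.finrank_mono (cl _ (cl D le_sup_left))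
    have h1 := Submodule.finrank_add_le_finrank_add_finrank D (Submodule.span ℝ {y 0})
    have h2 : Module.finrank ℝ (Submodule.span ℝ {y 0}) ≤ 1 := by
      simpa using finrank_span_le_card (R := ℝ) ({y 0} : Set L)
    rw [← hF] at h1
    omega
  exact ⟨⟨fun ⟨D, hD⟩ hb => key2 hb D hD, fun hb => ⟨_, key1 hb⟩⟩, key1, key2⟩
end
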